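/- Let α be a negative integer with -α ≤ n and let β > -1. Then for every h with 0 ≤ h ≤ n+α and all real x, the Bernstein polynomial satisfies B_h^n(x) = Σ_{i=-α}^{n} C(n+α, h)^{-1} C(n,h) b_{h, i+α}^{(n+α, -α, β)} Ĵ_i^{(α,β)}(x), where Ĵ_i^{(α,β)}(x) := (1-x)^{-α} R_{i+α}^{(-α,β)}(x). -/

import Mathlib

open Finset

/-- Pochhammer symbol `(x)_m = x (x+1) ⋯ (x+m-1)`. -/
noncomputable def poch (x : ℝ) (m : ℕ) : ℝ := ∏ j ∈ Finset.range m, (x + j)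

/-- Bernstein polynomial `B_j^n(x) = C(n,j) x^j (1-x)^(n-j)`. -/
noncomputable def bern (n j : ℕ) (x : ℝ) : ℝ := (n.choose j : ℝ) * x ^ j * (1 - x) ^ (n - j)

/-- Shifted Jacobi polynomial `R_i^(a,b)(x)`. -/
noncomputable def shiftedJacobi (a b : ℝ) (i : ℕ) (x : ℝ) : ℝ :=
  poch (a + 1) i / (Nat.factorial i : ℝ) *
    ∑ j ∈ Finset.range (i + 1),
      poch (-(i : ℝ)) j * poch ((i : ℝ) + a + b + 1) j /
        ((Nat.factorial j : ℝ) * poch (a + 1) j) * (1 - x) ^ j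

/-- Hahn polynomial `Q_m(t; a, b, N)`. -/
noncomputable def hahnQ (m : ℕ) (t : ℝ) (a b : ℝ) (N : ℕ) : ℝ :=
  ∑ j ∈ Finset.range (m + 1),
    poch (-(m : ℝ)) j * poch ((m : ℝ) + a + b + 1) j * poch (-t) j /
      ((Nat.factorial j : ℝ) * poch (a + 1) j * poch (-(N : ℝ)) j)

/-- Dual Hahn polynomial `R_m(λ(t); a, b, N)` with `λ(t) = t(t+a+b+1)`. -/
noncomputable def dualHahnR (m : ℕ) (t : ℝ) (a b : ℝ) (N : ℕ) : ℝ :=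
  ∑ j ∈ Finset.range (m + 1),
    poch (-(m : ℝ)) j * poch (t + a + b + 1) j * poch (-t) j /
      ((Nat.factorial j : ℝ) * poch (a + 1) j * poch (-(N : ℝ)) j)

/-- Modified Jacobi polynomial `J_{i,k,l}^(α,β)(x) = (1-x)^l x^k R_{i-k-l}^(α+2l,β+2k)(x)`. -/
noncomputable def modJacobi (α β : ℝ) (k l i : ℕ) (x : ℝ) : ℝ :=
  (1 - x) ^ l * x ^ k * shiftedJacobi (α + 2 * l) (β + 2 * k) (i - k - l) x

/-- Connection coefficient `c_{ih}` of the Bernstein form of the modified Jacobi polynomials. -/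
noncomputable def cCoef (α β : ℝ) (n k l i h : ℕ) : ℝ :=
  poch (α + 2 * l + 1) (i - k - l) / (Nat.factorial (i - k - l) : ℝ) *
    (n.choose h : ℝ)⁻¹ * ((n - k - l).choose (h - k) : ℝ) *
    hahnQ (i - k - l) ((n : ℝ) - l - h) (α + 2 * l) (β + 2 * k) (n - k - l)

/-- The quantity `z_{hi}`. -/
noncomputable def zCoef (α β : ℝ) (n k l h i : ℕ) : ℝ :=
  (n.choose h : ℝ) * (2 * (i : ℝ) + (α + β + 1)) * poch ((k : ℝ) + l - n) (i - k - l) *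
      poch (α + 2 * l + 1) (n - l - h) * poch (β + 2 * k + 1) (h - k) /
    (poch (α + 2 * l + 1) (i - k - l) * poch ((i : ℝ) + k + l + (α + β + 1)) (n + 1 - k - l))

/-- The quantity `w_{hi}`. -/
noncomputable def wCoef (α β : ℝ) (n k l h i : ℕ) : ℝ :=
  hahnQ (i - k - l) ((h : ℝ) - k) (β + 2 * k) (α + 2 * l) (n - k - l)

/-- Connection coefficient `d_{hi}` of the modified Jacobi form of Bernstein polynomials. -/
noncomputable def dCoef (α β : ℝ) (n k l h i : ℕ) : ℝ := zCoef α β n k l h i * wCoef α β n k l h i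

/-- Coefficient `a_{ih}^(m,a,b) = (-1)^i ((b+1)_i / i!) Q_i(h; b, a, m)`. -/
noncomputable def aCoef (m : ℕ) (a b : ℝ) (i h : ℕ) : ℝ :=
  (-1 : ℝ) ^ i * poch (b + 1) i / (Nat.factorial i : ℝ) * hahnQ i (h : ℝ) b a m

/-- Coefficient `b_{hi}^(m,a,b)`. -/
noncomputable def bCoef (m : ℕ) (a b : ℝ) (h i : ℕ) : ℝ :=
  (m.choose h : ℝ) * (2 * (i : ℝ) + a + b + 1) * poch (-(m : ℝ)) i * poch (a + 1) (m - h) *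
      poch (b + 1) h / (poch (a + 1) i * poch ((i : ℝ) + a + b + 1) (m + 1)) *
    hahnQ i (h : ℝ) b a m

open Polynomial

lemma poch_zero (x : ℝ) : poch x 0 = 1 := by simp [poch]

lemma poch_succ (x : ℝ) (m : ℕ) : poch x (m + 1) = poch x m * (x + m) := by
  simp [poch, Finset.prod_range_succ]

lemma poch_succ' (x : ℝ) (m : ℕ) : poch x (m + 1) = x * poch (x + 1) m := by
  simp only [poch, Finset.prod_range_succ']
  rw [mul_comm]
  congr 1
  · simp
  · refine Finset.prod_congr rfl fun j _ => ?_
    push_cast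
    ring

lemma poch_ne_zero_of_pos {x : ℝ} (hx : 0 < x) (m : ℕ) : poch x m ≠ 0 :=
  Finset.prod_ne_zero_iff.2 fun _ _ => by positivity

lemma poch_neg_ne_zero {m j : ℕ} (h : j ≤ m) : poch (-(m : ℝ)) j ≠ 0 := by
  refine Finset.prod_ne_zero_iff.2 fun k hk => ?_
  have hk' : (k : ℝ) < m := by
    exact_mod_cast lt_of_lt_of_le (Finset.mem_range.1 hk) h
  linarith

lemma poch_param_succ (a b : ℝ) (i j : ℕ) :
    poch (((i + 1 : ℕ) : ℝ) + a + b + 1) (j + 1) =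
      (i + a + b + 2) * poch ((i : ℝ) + (a + 1) + (b + 1) + 1) j := by
  rw [poch_succ', show ((i + 1 : ℕ) : ℝ) + a + b + 1 = i + a + b + 2 by push_cast; ring,
    show (i : ℝ) + a + b + 2 + 1 = (i : ℝ) + (a + 1) + (b + 1) + 1 by ring]

lemma poch_neg_succ (i j : ℕ) :
    poch (-((i + 1 : ℕ) : ℝ)) (j + 1) = -(i + 1) * poch (-(i : ℝ)) j := by
  rw [poch_succ']
  push_cast
  congr 2
  ring

lemma poch_neg_self (m : ℕ) : poch (-(m : ℝ)) (m + 1) = 0 := by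
  rw [poch_succ]; simp

/-- The hypergeometric terms of the Hahn polynomial, evaluated by the backward shift operator. -/
lemma poch_backward_shift (a b M u : ℝ) (j : ℕ) :
    (M + u) * (b + 1 - u) * poch u j + u * (a + M + 1 + u) * poch (u + 1) j =
      (a + b + 2 + j) * poch u (j + 1) + (M - j) * (b + 1 + j) * poch u j := by
  have h : u * poch (u + 1) j = poch u j * (u + j) := by rw [← poch_succ', poch_succ]
  rw [poch_succ]
  linear_combination (a + M + 1 + u) * h

/-- Backward shift relation for Hahn polynomials. -/
lemma hahnQ_backward_shift (a t : ℝ) {b : ℝ} (hb : -1 < b) {i m : ℕ} (him : i ≤ m) :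
    (b + 1) * (m + 1) * hahnQ (i + 1) t b a (m + 1) =
      (m + 1 - t) * (b + 1 + t) * hahnQ i t (b + 1) (a + 1) m -
        t * (a + m + 2 - t) * hahnQ i (t - 1) (b + 1) (a + 1) m := by
  set D : ℕ → ℝ := fun j => poch (-(i : ℝ)) j * poch ((i : ℝ) + (b + 1) + (a + 1) + 1) j /
    ((Nat.factorial j : ℝ) * poch (b + 1 + 1) j * poch (-(m : ℝ)) j) with hD
  have hD_last : D (i + 1) = 0 := by simp [hD, poch_neg_self]
  have hQ : ∀ s : ℝ, hahnQ i s (b + 1) (a + 1) m = ∑ j ∈ range (i + 1), D j * poch (-s) j := by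
    intro s
    refine Finset.sum_congr rfl fun j _ => ?_
    simp only [hD]
    ring
  have hrhs : (m + 1 - t) * (b + 1 + t) * hahnQ i t (b + 1) (a + 1) m -
        t * (a + m + 2 - t) * hahnQ i (t - 1) (b + 1) (a + 1) m =
      ∑ j ∈ range (i + 1), D j * ((a + b + 2 + j) * poch (-t) (j + 1)) +
        ∑ j ∈ range (i + 1), D j * ((m + 1 - j) * (b + 1 + j) * poch (-t) j) := by
    rw [hQ, hQ, Finset.mul_sum, Finset.mul_sum, ← Finset.sum_sub_distrib,
      ← Finset.sum_add_distrib]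
    refine Finset.sum_congr rfl fun j _ => ?_
    have h := poch_backward_shift a b (m + 1) (-t) j
    rw [show -(t - 1) = -t + 1 by ring]
    linear_combination D j * h
  have hext : ∑ j ∈ range (i + 1), D j * ((m + 1 - j) * (b + 1 + j) * poch (-t) j) =
      ∑ j ∈ range (i + 2), D j * ((m + 1 - j) * (b + 1 + j) * poch (-t) j) := by
    rw [Finset.sum_range_succ _ (i + 1), hD_last]
    ring
  rw [hrhs, hext, hahnQ, Finset.sum_range_succ' _ (i + 1), Finset.sum_range_succ' _ (i + 1),
    mul_add, ← add_assoc, ← Finset.sum_add_distrib, Finset.mul_sum]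
  congr 1
  · refine Finset.sum_congr rfl fun j hj => ?_
    have hji : j ≤ i := Nat.lt_succ_iff.1 (Finset.mem_range.1 hj)
    have h1 : poch (-(m : ℝ)) j ≠ 0 := poch_neg_ne_zero (hji.trans him)
    have h2 : poch (b + 1 + 1) j ≠ 0 := poch_ne_zero_of_pos (by linarith) j
    have h3 : b + 1 ≠ 0 := by linarith
    have h4 : (m : ℝ) + 1 ≠ 0 := by positivity
    have h5 : b + 1 + 1 + j ≠ 0 := by
      have : (0 : ℝ) ≤ j := j.cast_nonneg
      linarith
    have h6 : ((j + 1 : ℕ) : ℝ) ≠ 0 := by positivity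
    have h7 : (Nat.factorial j : ℝ) ≠ 0 := by positivity
    have hDs : D (j + 1) * ((m + 1 - (j + 1 : ℕ)) * (b + 1 + (j + 1 : ℕ))) =
        -D j * ((j - i) * (i + b + a + 3 + j)) / (j + 1 : ℕ) := by
      simp only [hD, poch_succ _ j, Nat.factorial_succ, Nat.cast_mul]
      rcases eq_or_ne ((-(m : ℝ)) + j) 0 with h8 | h8
      · have hjm : j = m := by
          have : (j : ℝ) = m := by linarith
          exact_mod_cast this
        obtain rfl : j = i := by omega
        subst hjm
        simp
      · push_cast at h6 ⊢
        field_simp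
        ring
    rw [show D (j + 1) * ((m + 1 - ((j + 1 : ℕ) : ℝ)) * (b + 1 + ((j + 1 : ℕ) : ℝ)) *
      poch (-t) (j + 1)) = D (j + 1) * ((m + 1 - (j + 1 : ℕ)) * (b + 1 + (j + 1 : ℕ))) *
        poch (-t) (j + 1) by ring, hDs, poch_neg_succ, poch_neg_succ, poch_param_succ, poch_succ' (b + 1) j, Nat.factorial_succ]
    simp only [hD]
    push_cast at h6 ⊢
    field_simp
    ring
  · simp [hD, poch_zero]
    ring

/-- The shifted Jacobi polynomial as a polynomial in the variable `1 - x`. -/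
noncomputable def jacobiPoly (a b : ℝ) (i : ℕ) : ℝ[X] :=
  ∑ j ∈ range (i + 1), C (poch (a + 1) i / (Nat.factorial i : ℝ) *
    (poch (-(i : ℝ)) j * poch ((i : ℝ) + a + b + 1) j /
        ((Nat.factorial j : ℝ) * poch (a + 1) j))) * X ^ j

lemma eval_jacobiPoly (a b : ℝ) (i : ℕ) (x : ℝ) :
    (jacobiPoly a b i).eval (1 - x) = shiftedJacobi a b i x := by
  simp only [jacobiPoly, shiftedJacobi, eval_finsetSum, eval_mul, eval_C, eval_pow, eval_X,
    Finset.mul_sum]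
  exact Finset.sum_congr rfl fun j _ => by ring

lemma jacobiPoly_zero (a b : ℝ) : jacobiPoly a b 0 = 1 := by
  simp [jacobiPoly, poch_zero]

lemma derivative_jacobiPoly_succ {a : ℝ} (ha : 0 < a) (b : ℝ) (i : ℕ) :
    derivative (jacobiPoly a b (i + 1)) =
      C (-(i + a + b + 2)) * jacobiPoly (a + 1) (b + 1) i := by
  rw [jacobiPoly, jacobiPoly, derivative_sum, Finset.sum_range_succ', Finset.mul_sum]
  simp only [pow_zero, mul_one, derivative_C, add_zero]
  refine Finset.sum_congr rfl fun j _ => ?_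
  rw [derivative_C_mul, derivative_X_pow, Nat.add_sub_cancel, ← mul_assoc,
    ← mul_assoc, ← C_mul, ← C_mul]
  congr 2
  have h1 : poch (a + 1 + 1) j ≠ 0 := poch_ne_zero_of_pos (by linarith) j
  have h2 : a + 1 ≠ 0 := by linarith
  rw [poch_neg_succ, poch_param_succ, poch_succ' (a + 1) i, poch_succ' (a + 1) j, Nat.factorial_succ, Nat.factorial_succ]
  push_cast
  field_simp

/-- The normalized Beta moment functional for the weight `x ^ b * (1 - x) ^ a`, on polynomials
in the variable `1 - x`. -/
noncomputable def betaMoment (a b : ℝ) : ℝ[X] →ₗ[ℝ] ℝ :=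
  Polynomial.lsum fun q => (poch (a + 1) q / poch (a + b + 2) q) • LinearMap.id

lemma betaMoment_C_mul (a b r : ℝ) (p : ℝ[X]) :
    betaMoment a b (C r * p) = r * betaMoment a b p := by
  rw [← smul_eq_C_mul, map_smul, smul_eq_mul]

lemma betaMoment_X_pow (a b : ℝ) (q : ℕ) :
    betaMoment a b (X ^ q) = poch (a + 1) q / poch (a + b + 2) q := by
  rw [betaMoment, Polynomial.lsum_apply, ← monomial_one_right_eq_X_pow,
    sum_monomial_index _ _ (by simp)]
  simp

lemma betaMoment_one (a b : ℝ) : betaMoment a b 1 = 1 := by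
  simpa [poch_zero] using betaMoment_X_pow a b 0

lemma betaMoment_mul_pow {a b : ℝ} (hab : 0 < a + b + 2) (p q : ℕ) :
    betaMoment a b ((1 - X) ^ p * X ^ q) =
      poch (b + 1) p * poch (a + 1) q / poch (a + b + 2) (p + q) := by
  induction p generalizing q with
  | zero => simp [betaMoment_X_pow, poch_zero]
  | succ p ih =>
    rw [show ((1 : ℝ[X]) - X) ^ (p + 1) * X ^ q = (1 - X) ^ p * X ^ q - (1 - X) ^ p * X ^ (q + 1)
      by ring, map_sub, ih, ih, show p + (q + 1) = p + q + 1 by ring,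
      show p + 1 + q = p + q + 1 by ring, poch_succ, poch_succ, poch_succ]
    have h1 := poch_ne_zero_of_pos hab (p + q)
    have h2 : a + b + 2 + ((p + q : ℕ) : ℝ) ≠ 0 := by positivity
    field_simp
    push_cast
    ring

/-- Partial sums of the Chu–Vandermonde series `₂F₁(-i, i + s - 1; s; 1)`. -/
lemma sum_poch_vandermonde {s : ℝ} (hs : 0 < s) (i : ℝ) (J : ℕ) :
    ∑ j ∈ range (J + 1), poch (-i) j * poch (i + s - 1) j / ((Nat.factorial j : ℝ) * poch s j) =
      poch (1 - i) J * poch (i + s) J / ((Nat.factorial J : ℝ) * poch s J) := by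
  induction J with
  | zero => simp [poch_zero]
  | succ J ih =>
    have h1 := poch_ne_zero_of_pos hs J
    have h2 : s + (J : ℝ) ≠ 0 := by positivity
    rw [Finset.sum_range_succ, ih, poch_succ' (-i), poch_succ' (i + s - 1),
      show -i + 1 = 1 - i by ring, show i + s - 1 + 1 = i + s by ring, poch_succ (1 - i),
      poch_succ (i + s), poch_succ s, Nat.factorial_succ]
    push_cast
    field_simp
    ring

lemma betaMoment_jacobiPoly_succ {a b : ℝ} (ha : 0 < a) (hb : -1 < b) (i : ℕ) :
    betaMoment a b (jacobiPoly a b (i + 1)) = 0 := by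
  have h := sum_poch_vandermonde (s := a + b + 2) (by linarith) ((i + 1 : ℕ) : ℝ) (i + 1)
  rw [show 1 - ((i + 1 : ℕ) : ℝ) = -(i : ℝ) by push_cast; ring, poch_neg_self] at h
  simp only [zero_mul, zero_div] at h
  rw [jacobiPoly, map_sum]
  trans poch (a + 1) (i + 1) / (Nat.factorial (i + 1) : ℝ) * 0
  · rw [← h, Finset.mul_sum]
    refine Finset.sum_congr rfl fun j _ => ?_
    have h1 : poch (a + 1) j ≠ 0 := poch_ne_zero_of_pos (by linarith) j
    rw [betaMoment_C_mul, betaMoment_X_pow,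
      show ((i + 1 : ℕ) : ℝ) + (a + b + 2) - 1 = ((i + 1 : ℕ) : ℝ) + a + b + 1 by ring]
    field_simp
  · simp

/-- The Bernstein polynomial as a polynomial in the variable `1 - x`. -/
noncomputable def bernPoly (m h : ℕ) : ℝ[X] := C (m.choose h : ℝ) * ((1 - X) ^ h * X ^ (m - h))

lemma eval_bernPoly (m h : ℕ) (x : ℝ) : (bernPoly m h).eval (1 - x) = bern m h x := by
  simp [bernPoly, bern, mul_assoc]

lemma bernPoly_of_lt {m h : ℕ} (hmh : m < h) : bernPoly m h = 0 := by
  simp [bernPoly, Nat.choose_eq_zero_of_lt hmh]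

lemma bCoef_of_lt {m h : ℕ} (hmh : m < h) (a b : ℝ) (i : ℕ) : bCoef m a b h i = 0 := by
  simp [bCoef, Nat.choose_eq_zero_of_lt hmh]

lemma cast_choose_succ_mul (m h : ℕ) :
    ((m.choose (h + 1) : ℕ) : ℝ) * (h + 1) = m.choose h * (m - h : ℕ) := by
  exact_mod_cast Nat.choose_succ_right_eq m h

lemma cast_choose_succ_succ_mul (m h : ℕ) :
    (((m + 1).choose (h + 1) : ℕ) : ℝ) * (h + 1) = (m + 1) * m.choose h := by
  exact_mod_cast (Nat.add_one_mul_choose_eq m h).symm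

lemma derivative_bernPoly_succ_zero (m : ℕ) :
    derivative (bernPoly (m + 1) 0) = C (m + 1 : ℝ) * bernPoly m 0 := by
  simp [bernPoly]

lemma derivative_bernPoly_succ_succ {m h : ℕ} (hh : h ≤ m) :
    derivative (bernPoly (m + 1) (h + 1)) =
      C (-(m + 1 : ℝ)) * (bernPoly m h - bernPoly m (h + 1)) := by
  obtain ⟨k, rfl⟩ := Nat.exists_eq_add_of_le hh
  have e2 := congrArg (C (R := ℝ)) (cast_choose_succ_succ_mul (h + k) h)
  have e3 : ((((h + k + 1).choose (h + 1) : ℕ)) : ℝ) * k =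
      (h + k + 1) * (h + k).choose (h + 1) := by
    have hp : (((h + k + 1).choose (h + 1) : ℕ) : ℝ) =
      (h + k).choose h + (h + k).choose (h + 1) := by exact_mod_cast Nat.choose_succ_succ _ _
    have := cast_choose_succ_mul (h + k) h
    rw [Nat.add_sub_cancel_left] at this
    rw [hp]
    linear_combination -this
  replace e3 := congrArg (C (R := ℝ)) e3
  cases k with
  | zero =>
    simp [bernPoly, derivative_pow]
    ring
  | succ k =>
    simp only [bernPoly, show h + (k + 1) + 1 - (h + 1) = k + 1 by omega,
      show h + (k + 1) - (h + 1) = k by omega, show h + (k + 1) - h = k + 1 by omega]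
    rw [derivative_C_mul, derivative_mul, derivative_pow, derivative_X_pow]
    simp only [derivative_sub, derivative_one, derivative_X, Nat.add_sub_cancel]
    simp only [map_mul, map_add, map_natCast, map_one, map_neg, Nat.cast_add, Nat.cast_one]
      at e2 e3 ⊢
    linear_combination -(1 - X) ^ h * X ^ (k + 1) * e2 + (1 - X) ^ (h + 1) * X ^ k * e3

lemma bCoef_succ_zero {a b : ℝ} (ha : 0 < a) (hb : -1 < b) {i m : ℕ} (him : i ≤ m) :
    (i + a + b + 2) * bCoef (m + 1) a b 0 (i + 1) =
      -(m + 1) * bCoef m (a + 1) (b + 1) 0 i := by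
  have hQ := hahnQ_backward_shift a 0 hb him
  have h1 : poch (a + 1 + 1) i ≠ 0 := poch_ne_zero_of_pos (by linarith) i
  have h2 : poch ((i : ℝ) + (a + 1) + (b + 1) + 1) (m + 1) ≠ 0 :=
    poch_ne_zero_of_pos (by have : (0 : ℝ) ≤ i := i.cast_nonneg; linarith) _
  have h3 : a + 1 ≠ 0 := by linarith
  have h4 : (i : ℝ) + a + b + 2 ≠ 0 := by
    have : (0 : ℝ) ≤ i := i.cast_nonneg
    linarith
  have h5 : b + 1 ≠ 0 := by linarith
  have h6 : (m : ℝ) + 1 ≠ 0 := by positivity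
  have hQ' : hahnQ (i + 1) 0 b a (m + 1) = hahnQ i 0 (b + 1) (a + 1) m := by
    refine mul_left_cancel₀ (mul_ne_zero h5 h6) ?_
    linear_combination hQ
  simp only [bCoef, Nat.sub_zero, Nat.choose_zero_right, Nat.cast_zero, poch_zero, hQ']
  rw [poch_neg_succ, poch_param_succ, poch_succ' (a + 1) m, poch_succ' (a + 1) i]
  push_cast
  field_simp
  ring

lemma bCoef_succ_succ {a b : ℝ} (ha : 0 < a) (hb : -1 < b) {i m h : ℕ} (him : i ≤ m)
    (hh : h ≤ m) :
    (i + a + b + 2) * bCoef (m + 1) a b (h + 1) (i + 1) =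
      (m + 1) * (bCoef m (a + 1) (b + 1) h i - bCoef m (a + 1) (b + 1) (h + 1) i) := by
  have hQ := hahnQ_backward_shift a (h + 1) hb him
  have h1 : poch (a + 1 + 1) i ≠ 0 := poch_ne_zero_of_pos (by linarith) i
  have h2 : poch ((i : ℝ) + (a + 1) + (b + 1) + 1) (m + 1) ≠ 0 :=
    poch_ne_zero_of_pos (by have : (0 : ℝ) ≤ i := i.cast_nonneg; linarith) _
  have h3 : a + 1 ≠ 0 := by linarith
  have h4 : (i : ℝ) + a + b + 2 ≠ 0 := by
    have : (0 : ℝ) ≤ i := i.cast_nonneg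
    linarith
  have h5 : b + 1 ≠ 0 := by linarith
  have h6 : (m : ℝ) + 1 ≠ 0 := by positivity
  have h7 : (h : ℝ) + 1 ≠ 0 := by positivity
  have c1 := eq_div_of_mul_eq h7 (cast_choose_succ_mul m h)
  have c2 := eq_div_of_mul_eq h7 (cast_choose_succ_succ_mul m h)
  rw [add_sub_cancel_right] at hQ
  have hQ' := eq_div_of_mul_eq (mul_ne_zero h5 h6) ((mul_comm _ _).trans hQ)
  simp only [bCoef, Nat.add_sub_add_right, Nat.cast_add_one h, hQ']
  rw [c1, c2, poch_neg_succ, poch_param_succ, poch_succ' (a + 1) i,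
    poch_succ' (b + 1) h, poch_succ (b + 1 + 1) h]
  obtain ⟨k, rfl⟩ := Nat.exists_eq_add_of_le hh
  cases k with
  | zero =>
    simp [poch_zero]
    field_simp
    ring
  | succ k =>
    rw [show h + (k + 1) - h = k + 1 by omega, show h + (k + 1) - (h + 1) = k by omega,
      poch_succ' (a + 1) k, poch_succ (a + 1 + 1) k]
    push_cast at h6 ⊢
    field_simp
    ring

lemma betaMoment_bernPoly {a b : ℝ} (ha : 0 < a) (hb : -1 < b) {m h : ℕ} (hh : h ≤ m) :
    betaMoment a b (bernPoly m h) = bCoef m a b h 0 := by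
  have h1 := poch_ne_zero_of_pos (show 0 < a + b + 2 by linarith) m
  have h2 : a + b + 1 ≠ 0 := by linarith
  rw [bernPoly, betaMoment_C_mul, betaMoment_mul_pow (by linarith), Nat.add_sub_cancel' hh, bCoef]
  simp only [hahnQ, poch_zero, poch_succ', Nat.cast_zero]
  rw [show 0 + a + b + 1 + 1 = a + b + 2 by ring]
  simp [poch_zero]
  field_simp

/-- Jacobi form of the Bernstein polynomials. -/
theorem bernPoly_eq_sum_bCoef_mul_jacobiPoly (m h : ℕ) {a b : ℝ} (ha : 0 < a) (hb : -1 < b) :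
    bernPoly m h = ∑ i ∈ range (m + 1), C (bCoef m a b h i) * jacobiPoly a b i := by
  induction m generalizing h a b with
  | zero =>
    rcases Nat.eq_zero_or_pos h with rfl | hpos
    · have h2 : a + b + 1 ≠ 0 := by linarith
      simp [bernPoly, jacobiPoly_zero, bCoef, hahnQ, poch_zero, poch_succ, h2]
    · simp [bernPoly_of_lt hpos, bCoef_of_lt hpos]
  | succ m ih =>
    rcases lt_or_ge (m + 1) h with hlt | hle
    · simp [bernPoly_of_lt hlt, bCoef_of_lt hlt]
    have hder : derivative (bernPoly (m + 1) h -
        ∑ i ∈ range (m + 1 + 1), C (bCoef (m + 1) a b h i) * jacobiPoly a b i) = 0 := by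
      rw [derivative_sub, sub_eq_zero, derivative_sum, Finset.sum_range_succ', jacobiPoly_zero]
      simp only [mul_one, derivative_C, add_zero, derivative_C_mul, derivative_jacobiPoly_succ ha]
      cases h with
      | zero =>
        rw [derivative_bernPoly_succ_zero, ih 0 (a := a + 1) (b := b + 1) (by linarith)
          (by linarith), Finset.mul_sum]
        refine Finset.sum_congr rfl fun i hi => ?_
        rw [← mul_assoc, ← mul_assoc, ← C_mul, ← C_mul]
        congr 2
        have := bCoef_succ_zero ha hb (Nat.lt_succ_iff.1 (Finset.mem_range.1 hi))
        linarith
      | succ h =>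
        rw [derivative_bernPoly_succ_succ (by omega), ih h (a := a + 1) (b := b + 1) (by linarith)
          (by linarith), ih (h + 1) (a := a + 1) (b := b + 1) (by linarith) (by linarith),
          ← Finset.sum_sub_distrib, Finset.mul_sum]
        refine Finset.sum_congr rfl fun i hi => ?_
        rw [← sub_mul, ← mul_assoc, ← mul_assoc, ← C_sub, ← C_mul, ← C_mul]
        congr 2
        have := bCoef_succ_succ ha hb (Nat.lt_succ_iff.1 (Finset.mem_range.1 hi))
          (show h ≤ m by omega)
        linarith
    have hmom : betaMoment a b (bernPoly (m + 1) h -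
        ∑ i ∈ range (m + 1 + 1), C (bCoef (m + 1) a b h i) * jacobiPoly a b i) = 0 := by
      rw [map_sub, map_sum, Finset.sum_range_succ', betaMoment_bernPoly ha hb hle]
      simp only [betaMoment_C_mul, betaMoment_jacobiPoly_succ ha hb, jacobiPoly_zero,
        betaMoment_one]
      simp
    rw [← sub_eq_zero]
    have hconst := eq_C_of_natDegree_eq_zero (derivative_eq_zero.1 hder)
    rw [hconst, ← mul_one (C _), betaMoment_C_mul, betaMoment_one, mul_one] at hmom
    rw [hconst, hmom, C_0]

theorem bern_eq_sum_bCoef_mul_shiftedJacobi (m h : ℕ) {a b : ℝ} (ha : 0 < a) (hb : -1 < b)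
    (x : ℝ) :
    bern m h x = ∑ i ∈ range (m + 1), bCoef m a b h i * shiftedJacobi a b i x := by
  rw [← eval_bernPoly, bernPoly_eq_sum_bCoef_mul_jacobiPoly m h ha hb, eval_finsetSum]
  simp [eval_jacobiPoly]

/-- Generalized Jacobi polynomials, case `α ∈ ℤ⁻`, `β > -1`: generalized Jacobi form of the
Bernstein polynomials. -/
theorem bernstein_genJacobi_form_neg_alpha (n : ℕ) (α : ℤ) (hα : α < 0) (hαn : -α ≤ (n : ℤ))
    (β : ℝ) (hβ : -1 < β) :
    ∀ h : ℕ, (h : ℤ) ≤ (n : ℤ) + α → ∀ x : ℝ,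
      bern n h x =
        ∑ i ∈ Finset.Icc (-α).toNat n,
          (((n : ℤ) + α).toNat.choose h : ℝ)⁻¹ * (n.choose h : ℝ) *
            bCoef ((n : ℤ) + α).toNat ((-α : ℤ) : ℝ) β h ((i : ℤ) + α).toNat *
            ((1 - x) ^ (-α).toNat * shiftedJacobi ((-α : ℤ) : ℝ) β ((i : ℤ) + α).toNat x) := by
  intro h hh x
  obtain ⟨k, hk⟩ := Int.eq_ofNat_of_zero_le (show 0 ≤ -α by omega)
  obtain rfl : α = -(k : ℤ) := by omega
  obtain ⟨m, rfl⟩ := Nat.exists_eq_add_of_le (show k ≤ n by omega)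
  have hm : (((k + m : ℕ) : ℤ) + -(k : ℤ)).toNat = m := by omega
  have hhm : h ≤ m := by omega
  have hchoose : (m.choose h : ℝ) ≠ 0 := by exact_mod_cast (Nat.choose_pos hhm).ne'
  have hk0 : (0 : ℝ) < ((- -(k : ℤ) : ℤ) : ℝ) := by exact_mod_cast (by omega : 0 < - -(k : ℤ))
  have hsum := bern_eq_sum_bCoef_mul_shiftedJacobi m h hk0 hβ x
  rw [hm, show (- -(k : ℤ)).toNat = k by omega, ← Finset.Ico_add_one_right_eq_Icc,
    Finset.sum_Ico_eq_sum_range, show k + m + 1 - k = m + 1 by omega]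
  trans (m.choose h : ℝ)⁻¹ * ((k + m).choose h : ℝ) * (1 - x) ^ k * bern m h x
  · rw [bern, bern, show k + m - h = k + (m - h) by omega, pow_add]
    field_simp
  · rw [hsum, Finset.mul_sum]
    refine Finset.sum_congr rfl fun i _ => ?_
    rw [show (((k + i : ℕ) : ℤ) + -(k : ℤ)).toNat = i by omega]
    ring
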